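/- For any m ≥ 1 and any r + s ≥ 1, the nilpotent Lie superalgebra H_m ⊕ A(r | s) over a field F (char F ≠ 2,3) is capable if and only if m = 1. -/

import Mathlib

/-!
Common definitions: Lie superalgebras over a field `F` (char ≠ 2,3 where needed),
graded ideals, centers, capability, epicenter, non-abelian tensor and exterior
products (characterized by generators-and-relations universal properties),
free Lie superalgebras, Schur multipliers, Heisenberg Lie superalgebras, etc.
-/

namespace SuperLie

open Submodule Function Module

universe u v w

/-- The sign `(-1)^{|a||b|}` attached to a pair of `ℤ₂`-degrees. -/
def sg (F : Type u) [Field F] (a b : ZMod 2) : F := (-1 : F) ^ (a.val * b.val)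

/-- A Lie superalgebra over `F`: a `ℤ₂`-graded vector space `L = L₀ ⊕ L₁`
together with an even bilinear bracket satisfying graded skew-symmetry and the
graded Jacobi identity (on homogeneous elements). -/
class LieSuper (F : Type u) [Field F] (L : Type v) [AddCommGroup L] [Module F L] where
  gr : ZMod 2 → Submodule F L
  isCompl_gr : IsCompl (gr 0) (gr 1)
  br : L → L → L
  br_add_left : ∀ x y z : L, br (x + y) z = br x z + br y z
  br_add_right : ∀ x y z : L, br x (y + z) = br x y + br x z
  br_smul_left : ∀ (c : F) (x y : L), br (c • x) y = c • br x y
  br_smul_right : ∀ (c : F) (x y : L), br x (c • y) = c • br x y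
  br_gr : ∀ a b : ZMod 2, ∀ x ∈ gr a, ∀ y ∈ gr b, br x y ∈ gr (a + b)
  br_skew : ∀ a b : ZMod 2, ∀ x ∈ gr a, ∀ y ∈ gr b, br x y = -(sg F a b) • br y x
  br_jacobi : ∀ a b c : ZMod 2, ∀ x ∈ gr a, ∀ y ∈ gr b, ∀ z ∈ gr c,
    sg F a c • br x (br y z) + sg F b a • br y (br z x) + sg F c b • br z (br x y) = 0

/-- The `a`-graded piece of a Lie superalgebra. -/
def grd (F : Type u) [Field F] (L : Type v) [AddCommGroup L] [Module F L] [LieSuper F L]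
    (a : ZMod 2) : Submodule F L :=
  LieSuper.gr a

/-- The bracket of a Lie superalgebra. -/
def sbr (F : Type u) [Field F] {L : Type v} [AddCommGroup L] [Module F L] [LieSuper F L]
    (x y : L) : L :=
  LieSuper.br (F := F) x y

/-- The center `Z(L) = {z ∈ L : [z,x] = 0 for all x ∈ L}`. -/
def centerS (F : Type u) [Field F] (L : Type v) [AddCommGroup L] [Module F L] [LieSuper F L] :
    Submodule F L where
  carrier := {z : L | ∀ x : L, sbr F z x = 0}
  add_mem' := by
    intro a b ha hb x
    simp only [Set.mem_setOf_eq, sbr] at ha hb ⊢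
    rw [LieSuper.br_add_left, ha x, hb x, add_zero]
  zero_mem' := by
    intro x
    have h := LieSuper.br_smul_left (F := F) (0 : F) (0 : L) x
    simp only [Set.mem_setOf_eq, sbr, zero_smul] at h ⊢
    simpa using h
  smul_mem' := by
    intro c a ha x
    simp only [Set.mem_setOf_eq, sbr] at ha ⊢
    rw [LieSuper.br_smul_left, ha x, smul_zero]

/-- Homomorphisms of Lie superalgebras: even (grading preserving) linear maps
which preserve the bracket. -/
def IsHom (F : Type u) [Field F] {L : Type v} {M : Type w}
    [AddCommGroup L] [Module F L] [LieSuper F L]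
    [AddCommGroup M] [Module F M] [LieSuper F M] (f : L →ₗ[F] M) : Prop :=
  (∀ a : ZMod 2, ∀ x ∈ grd F L a, f x ∈ grd F M a) ∧
  (∀ x y : L, f (sbr F x y) = sbr F (f x) (f y))

/-- A bundled Lie superalgebra over `F`. -/
structure LieSupAlg (F : Type u) [Field F] : Type (max u (v + 1)) where
  carrier : Type v
  [iag : AddCommGroup carrier]
  [imo : Module F carrier]
  [ils : LieSuper F carrier]

attribute [instance] LieSupAlg.iag LieSupAlg.imo LieSupAlg.ils

instance (F : Type u) [Field F] : CoeSort (LieSupAlg.{u, v} F) (Type v) :=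
  ⟨LieSupAlg.carrier⟩

/-- A Lie superalgebra `L` is capable if `L ≅ H/Z(H)` for some Lie superalgebra `H`,
i.e. there is a surjective homomorphism onto `L` whose kernel is exactly the center. -/
def Capable (F : Type u) [Field F] (L : Type v) [AddCommGroup L] [Module F L]
    [LieSuper F L] : Prop :=
  ∃ (H : LieSupAlg.{u, max u v} F) (φ : H.carrier →ₗ[F] L),
    IsHom F φ ∧ Surjective φ ∧ LinearMap.ker φ = centerS F H.carrier

/-- Graded ideals of a Lie superalgebra. -/
def IsGIdeal (F : Type u) [Field F] {L : Type v} [AddCommGroup L] [Module F L]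
    [LieSuper F L] (I : Submodule F L) : Prop :=
  (∀ x ∈ I, ∀ y : L, sbr F x y ∈ I) ∧ (∀ y : L, ∀ x ∈ I, sbr F y x ∈ I) ∧
  (∀ x ∈ I, ∃ x0 ∈ I ⊓ grd F L 0, ∃ x1 ∈ I ⊓ grd F L 1, x = x0 + x1)

/-- The graded ideal generated by a subset. -/
def idealClosure (F : Type u) [Field F] {L : Type v} [AddCommGroup L] [Module F L]
    [LieSuper F L] (S : Set L) : Submodule F L :=
  sInf {I : Submodule F L | IsGIdeal F I ∧ S ⊆ ↑I}

/-- `QuotCapable F L N` expresses that the quotient Lie superalgebra `L/N` is capable. -/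
def QuotCapable (F : Type u) [Field F] (L : Type v) [AddCommGroup L] [Module F L]
    [LieSuper F L] (N : Submodule F L) : Prop :=
  ∃ (Q : LieSupAlg.{u, max u v} F) (π : L →ₗ[F] Q.carrier),
    IsHom F π ∧ Surjective π ∧ LinearMap.ker π = N ∧ Capable F Q.carrier

/-- The epicenter `Z^*(L)`: the smallest graded ideal of `L` such that the
corresponding quotient is capable. -/
def IsEpicenter (F : Type u) [Field F] (L : Type v) [AddCommGroup L] [Module F L]
    [LieSuper F L] (Z : Submodule F L) : Prop :=
  IsGIdeal F Z ∧ QuotCapable F L Z ∧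
  ∀ N : Submodule F L, IsGIdeal F N → QuotCapable F L N → Z ≤ N

/-- The submodule `[I,J]` spanned by brackets. -/
def bracketSpan (F : Type u) [Field F] {L : Type v} [AddCommGroup L] [Module F L]
    [LieSuper F L] (I J : Submodule F L) : Submodule F L :=
  Submodule.span F {z : L | ∃ x ∈ I, ∃ y ∈ J, z = sbr F x y}

/-- The derived subalgebra `L' = [L,L]`. -/
def derived (F : Type u) [Field F] (L : Type v) [AddCommGroup L] [Module F L]
    [LieSuper F L] : Submodule F L :=
  bracketSpan F (⊤ : Submodule F L) ⊤

/-- The lower central series of a Lie superalgebra. -/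
def lowerCentral (F : Type u) [Field F] (L : Type v) [AddCommGroup L] [Module F L]
    [LieSuper F L] : ℕ → Submodule F L
  | 0 => ⊤
  | n + 1 => bracketSpan F (lowerCentral F L n) ⊤

/-- A Lie superalgebra is nilpotent if its lower central series terminates at zero. -/
def IsNilp (F : Type u) [Field F] (L : Type v) [AddCommGroup L] [Module F L]
    [LieSuper F L] : Prop :=
  ∃ n : ℕ, lowerCentral F L n = ⊥

/-- An action of a Lie superalgebra `P` on a Lie superalgebra `M`:
an even bilinear map satisfying the two action axioms. -/
structure IsAction (F : Type u) [Field F] {P : Type v} {M : Type v}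
    [AddCommGroup P] [Module F P] [LieSuper F P]
    [AddCommGroup M] [Module F M] [LieSuper F M] (act : P → M → M) : Prop where
  add_left : ∀ (p q : P) (m : M), act (p + q) m = act p m + act q m
  add_right : ∀ (p : P) (m m' : M), act p (m + m') = act p m + act p m'
  smul_left : ∀ (c : F) (p : P) (m : M), act (c • p) m = c • act p m
  smul_right : ∀ (c : F) (p : P) (m : M), act p (c • m) = c • act p m
  grade : ∀ a b : ZMod 2, ∀ p ∈ grd F P a, ∀ m ∈ grd F M b, act p m ∈ grd F M (a + b)
  br_act : ∀ a b : ZMod 2, ∀ p ∈ grd F P a, ∀ p' ∈ grd F P b, ∀ m : M,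
    act (sbr F p p') m = act p (act p' m) - sg F a b • act p' (act p m)
  act_br : ∀ a b : ZMod 2, ∀ p ∈ grd F P a, ∀ m ∈ grd F M b, ∀ m' : M,
    act p (sbr F m m') = sbr F (act p m) m' + sg F a b • sbr F m (act p m')

/-- Compatibility of mutual actions of two Lie superalgebras on each other. -/
def Compatible (F : Type u) [Field F] {M : Type v} {N : Type v}
    [AddCommGroup M] [Module F M] [LieSuper F M]
    [AddCommGroup N] [Module F N] [LieSuper F N]
    (actMN : M → N → N) (actNM : N → M → M) : Prop :=
  (∀ a b : ZMod 2, ∀ m ∈ grd F M a, ∀ n ∈ grd F N b, ∀ n' : N,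
      actMN (actNM n m) n' = -(sg F a b) • sbr F (actMN m n) n') ∧
  (∀ a b : ZMod 2, ∀ m ∈ grd F M a, ∀ n ∈ grd F N b, ∀ m' : M,
      actNM (actMN m n) m' = -(sg F a b) • sbr F (actNM n m) m')

/-- The defining relations of the non-abelian tensor product `M ⊗ N` of Lie
superalgebras (with given mutual actions), satisfied by a pairing `q` into `T`. -/
structure TensorRel (F : Type u) [Field F] {M : Type v} {N : Type v} {T : Type w}
    [AddCommGroup M] [Module F M] [LieSuper F M]
    [AddCommGroup N] [Module F N] [LieSuper F N]
    [AddCommGroup T] [Module F T] [LieSuper F T]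
    (actMN : M → N → N) (actNM : N → M → M) (q : M → N → T) : Prop where
  add_left : ∀ (m m' : M) (n : N), q (m + m') n = q m n + q m' n
  add_right : ∀ (m : M) (n n' : N), q m (n + n') = q m n + q m n'
  smul_left : ∀ (c : F) (m : M) (n : N), q (c • m) n = c • q m n
  smul_right : ∀ (c : F) (m : M) (n : N), q m (c • n) = c • q m n
  grade : ∀ a b : ZMod 2, ∀ m ∈ grd F M a, ∀ n ∈ grd F N b, q m n ∈ grd F T (a + b)
  brk_left : ∀ a b : ZMod 2, ∀ m ∈ grd F M a, ∀ m' ∈ grd F M b, ∀ n : N,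
    q (sbr F m m') n = q m (actMN m' n) - sg F a b • q m' (actMN m n)
  brk_right : ∀ a b c : ZMod 2, ∀ m ∈ grd F M a, ∀ n ∈ grd F N b, ∀ n' ∈ grd F N c,
    q m (sbr F n n') = sg F c (a + b) • q (actNM n' m) n - sg F a b • q (actNM n m) n'
  brk_brk : ∀ a b : ZMod 2, ∀ m ∈ grd F M a, ∀ n ∈ grd F N b, ∀ (m' : M) (n' : N),
    sbr F (q m n) (q m' n') = -(sg F a b) • q (actNM n m) (actMN m' n')

/-- `IsTensorObj F actMN actNM t` says that `(T, t)` is the non-abelian tensor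
product `M ⊗ N`: the pairing `t` satisfies the defining relations and is
universal among all pairings satisfying them. -/
structure IsTensorObj (F : Type u) [Field F] {M : Type v} {N : Type v} {T : Type v}
    [AddCommGroup M] [Module F M] [LieSuper F M]
    [AddCommGroup N] [Module F N] [LieSuper F N]
    [AddCommGroup T] [Module F T] [LieSuper F T]
    (actMN : M → N → N) (actNM : N → M → M) (t : M → N → T) : Prop where
  rel : TensorRel F actMN actNM t
  lift : ∀ (Q : LieSupAlg.{u, max u v} F) (q : M → N → Q.carrier),
    TensorRel F actMN actNM q →
    ∃! h : T →ₗ[F] Q.carrier, IsHom F h ∧ ∀ (m : M) (n : N), h (t m n) = q m n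

/-- The defining relations of the non-abelian exterior square `L ∧ L` of a Lie
superalgebra (the tensor relations for the bracket actions, together with the
graded alternating relations coming from `L □ L`). -/
structure ExtRel (F : Type u) [Field F] {L : Type v} {T : Type w}
    [AddCommGroup L] [Module F L] [LieSuper F L]
    [AddCommGroup T] [Module F T] [LieSuper F T] (q : L → L → T) : Prop where
  toTensor : TensorRel F (fun x y : L => sbr F x y) (fun x y : L => sbr F x y) q
  alt : ∀ a b : ZMod 2, ∀ x ∈ grd F L a, ∀ y ∈ grd F L b, q x y = -(sg F a b) • q y x
  alt_even : ∀ x ∈ grd F L 0, q x x = 0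

/-- `IsExtObj F t` says that `(E, t)` is the non-abelian exterior square `L ∧ L`. -/
structure IsExtObj (F : Type u) [Field F] {L : Type v} {E : Type v}
    [AddCommGroup L] [Module F L] [LieSuper F L]
    [AddCommGroup E] [Module F E] [LieSuper F E] (t : L → L → E) : Prop where
  rel : ExtRel F t
  lift : ∀ (Q : LieSupAlg.{u, max u v} F) (q : L → L → Q.carrier),
    ExtRel F q →
    ∃! h : E →ₗ[F] Q.carrier, IsHom F h ∧ ∀ x y : L, h (t x y) = q x y

/-- A free Lie superalgebra: free on some `ℤ₂`-graded subset `X`. -/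
def IsFreeLieSuper (F : Type u) [Field F] (Fr : Type v) [AddCommGroup Fr] [Module F Fr]
    [LieSuper F Fr] : Prop :=
  ∃ X : ZMod 2 → Set Fr,
    (∀ a : ZMod 2, X a ⊆ (grd F Fr a : Set Fr)) ∧
    ∀ (Q : LieSupAlg.{u, max u v} F) (f : ∀ a : ZMod 2, X a → Q.carrier),
      (∀ (a : ZMod 2) (x : X a), f a x ∈ grd F Q.carrier a) →
      ∃! h : Fr →ₗ[F] Q.carrier,
        IsHom F h ∧ ∀ (a : ZMod 2) (x : X a), h (x : Fr) = f a x

/-- `F' ∩ R`, for a free presentation with kernel `R`. -/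
abbrev schurA (F : Type u) [Field F] (Fr : Type v) [AddCommGroup Fr] [Module F Fr]
    [LieSuper F Fr] (R : Submodule F Fr) : Submodule F Fr :=
  derived F Fr ⊓ R

/-- The Schur multiplier `M(L) = (F' ∩ R)/[R,F]` attached to a free presentation
`0 → R → F → L → 0`. -/
abbrev SchurMul (F : Type u) [Field F] (Fr : Type v) [AddCommGroup Fr] [Module F Fr]
    [LieSuper F Fr] (R : Submodule F Fr) :=
  ↥(schurA F Fr R) ⧸ (Submodule.comap (schurA F Fr R).subtype (bracketSpan F R ⊤))

/-- `L` is (isomorphic to) the special Heisenberg Lie superalgebra `H(m,n)` with even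
center: basis `x₁,…,x_{2m}, z` (even), `y₁,…,y_n` (odd), with `[xᵢ, x_{m+i}] = z`,
`[y_j, y_j] = z` and `z` central. -/
def IsHeisE (F : Type u) [Field F] (m n : ℕ) (L : Type v) [AddCommGroup L] [Module F L]
    [LieSuper F L] : Prop :=
  ∃ (x : Fin (2 * m) → L) (y : Fin n → L) (z : L),
    (∀ i, x i ∈ grd F L 0) ∧ z ∈ grd F L 0 ∧ (∀ j, y j ∈ grd F L 1) ∧
    LinearIndependent F (Sum.elim x (Sum.elim y (fun _ : Unit => z))) ∧
    Submodule.span F (Set.range (Sum.elim x (Sum.elim y (fun _ : Unit => z)))) = ⊤ ∧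
    (∀ i j : Fin (2 * m), sbr F (x i) (x j) =
      if (j : ℕ) = (i : ℕ) + m then z else if (i : ℕ) = (j : ℕ) + m then -z else 0) ∧
    (∀ (i : Fin (2 * m)) (j : Fin n), sbr F (x i) (y j) = 0) ∧
    (∀ (i : Fin (2 * m)) (j : Fin n), sbr F (y j) (x i) = 0) ∧
    (∀ i j : Fin n, sbr F (y i) (y j) = if i = j then z else 0) ∧
    (∀ w : L, sbr F z w = 0) ∧ (∀ w : L, sbr F w z = 0)

/-- `L` is (isomorphic to) the Heisenberg Lie superalgebra `H_m` with odd center: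
basis `x₁,…,x_m` (even), `y₁,…,y_m, z` (odd), with `[x_j, y_j] = z` and `z` central. -/
def IsHeisO (F : Type u) [Field F] (m : ℕ) (L : Type v) [AddCommGroup L] [Module F L]
    [LieSuper F L] : Prop :=
  ∃ (x : Fin m → L) (y : Fin m → L) (z : L),
    (∀ i, x i ∈ grd F L 0) ∧ (∀ j, y j ∈ grd F L 1) ∧ z ∈ grd F L 1 ∧
    LinearIndependent F (Sum.elim x (Sum.elim y (fun _ : Unit => z))) ∧
    Submodule.span F (Set.range (Sum.elim x (Sum.elim y (fun _ : Unit => z)))) = ⊤ ∧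
    (∀ i j : Fin m, sbr F (x i) (x j) = 0) ∧
    (∀ i j : Fin m, sbr F (x i) (y j) = if i = j then z else 0) ∧
    (∀ i j : Fin m, sbr F (y j) (x i) = if i = j then -z else 0) ∧
    (∀ i j : Fin m, sbr F (y i) (y j) = 0) ∧
    (∀ w : L, sbr F z w = 0) ∧ (∀ w : L, sbr F w z = 0)

/-- `A` is (isomorphic to) the abelian Lie superalgebra `A(r | s)` of
superdimension `(r | s)`. -/
def IsAbelSuper (F : Type u) [Field F] (r s : ℕ) (A : Type v) [AddCommGroup A]
    [Module F A] [LieSuper F A] : Prop :=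
  (∀ x y : A, sbr F x y = 0) ∧ Module.Finite F A ∧
  Module.finrank F ↥(grd F A 0) = r ∧ Module.finrank F ↥(grd F A 1) = s

/-- The direct sum (product) of two Lie superalgebras. -/
instance prodLieSuper (F : Type u) [Field F] (A : Type v) (B : Type w)
    [AddCommGroup A] [Module F A] [LieSuper F A]
    [AddCommGroup B] [Module F B] [LieSuper F B] : LieSuper F (A × B) where
  gr a := (grd F A a).prod (grd F B a)
  isCompl_gr := by
    have hA : IsCompl (grd F A 0) (grd F A 1) := LieSuper.isCompl_gr
    have hB : IsCompl (grd F B 0) (grd F B 1) := LieSuper.isCompl_gr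
    constructor
    · rw [disjoint_iff, eq_bot_iff]
      rintro ⟨a, b⟩ h
      rw [Submodule.mem_inf] at h
      obtain ⟨h0, h1⟩ := h
      rw [Submodule.mem_prod] at h0 h1
      have ha : a = 0 := by
        have := hA.disjoint.le_bot (Submodule.mem_inf.mpr ⟨h0.1, h1.1⟩)
        simpa using this
      have hb : b = 0 := by
        have := hB.disjoint.le_bot (Submodule.mem_inf.mpr ⟨h0.2, h1.2⟩)
        simpa using this
      simp [ha, hb, Prod.ext_iff]
    · rw [codisjoint_iff, eq_top_iff]
      rintro ⟨a, b⟩ -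
      have ha' : a ∈ grd F A 0 ⊔ grd F A 1 := by
        rw [hA.codisjoint.eq_top]; trivial
      have hb' : b ∈ grd F B 0 ⊔ grd F B 1 := by
        rw [hB.codisjoint.eq_top]; trivial
      obtain ⟨a0, ha0, a1, ha1, rfl⟩ := Submodule.mem_sup.mp ha'
      obtain ⟨b0, hb0, b1, hb1, rfl⟩ := Submodule.mem_sup.mp hb'
      refine Submodule.mem_sup.mpr ⟨(a0, b0), ?_, (a1, b1), ?_, ?_⟩
      · exact Submodule.mem_prod.mpr ⟨ha0, hb0⟩
      · exact Submodule.mem_prod.mpr ⟨ha1, hb1⟩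
      · rfl
  br x y := (sbr F x.1 y.1, sbr F x.2 y.2)
  br_add_left := by
    intro x y z
    simp only [Prod.fst_add, Prod.snd_add, sbr, LieSuper.br_add_left]
    rfl
  br_add_right := by
    intro x y z
    simp only [Prod.fst_add, Prod.snd_add, sbr, LieSuper.br_add_right]
    rfl
  br_smul_left := by
    intro c x y
    simp only [Prod.smul_fst, Prod.smul_snd, sbr, LieSuper.br_smul_left]
    rfl
  br_smul_right := by
    intro c x y
    simp only [Prod.smul_fst, Prod.smul_snd, sbr, LieSuper.br_smul_right]
    rfl
  br_gr := by
    intro a b x hx y hy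
    rw [Submodule.mem_prod] at hx hy ⊢
    exact ⟨LieSuper.br_gr a b x.1 hx.1 y.1 hy.1, LieSuper.br_gr a b x.2 hx.2 y.2 hy.2⟩
  br_skew := by
    intro a b x hx y hy
    rw [Submodule.mem_prod] at hx hy
    have h1 := LieSuper.br_skew (F := F) a b x.1 hx.1 y.1 hy.1
    have h2 := LieSuper.br_skew (F := F) a b x.2 hx.2 y.2 hy.2
    simp only [sbr]
    rw [Prod.ext_iff]
    exact ⟨h1, h2⟩
  br_jacobi := by
    intro a b c x hx y hy z hz
    rw [Submodule.mem_prod] at hx hy hz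
    have h1 := LieSuper.br_jacobi (F := F) a b c x.1 hx.1 y.1 hy.1 z.1 hz.1
    have h2 := LieSuper.br_jacobi (F := F) a b c x.2 hx.2 y.2 hy.2 z.2 hz.2
    simp only [sbr]
    rw [Prod.ext_iff]
    exact ⟨h1, h2⟩


section aux

variable {F : Type u} [Field F]

theorem zm2 (a : ZMod 2) : a = 0 ∨ a = 1 := by revert a; decide

theorem sbr_al {L : Type v} [AddCommGroup L] [Module F L] [LieSuper F L] (x y z : L) :
    sbr F (x + y) z = sbr F x z + sbr F y z := LieSuper.br_add_left x y z

theorem sbr_ar {L : Type v} [AddCommGroup L] [Module F L] [LieSuper F L] (x y z : L) :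
    sbr F x (y + z) = sbr F x y + sbr F x z := LieSuper.br_add_right x y z

theorem sbr_sl {L : Type v} [AddCommGroup L] [Module F L] [LieSuper F L] (c : F) (x y : L) :
    sbr F (c • x) y = c • sbr F x y := LieSuper.br_smul_left c x y

theorem sbr_sr {L : Type v} [AddCommGroup L] [Module F L] [LieSuper F L] (c : F) (x y : L) :
    sbr F x (c • y) = c • sbr F x y := LieSuper.br_smul_right c x y

theorem sbr_zl {L : Type v} [AddCommGroup L] [Module F L] [LieSuper F L] (y : L) :
    sbr F (0 : L) y = 0 := by
  have := sbr_sl (0 : F) (0 : L) y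
  simpa using this

theorem sbr_zr {L : Type v} [AddCommGroup L] [Module F L] [LieSuper F L] (y : L) :
    sbr F y (0 : L) = 0 := by
  have := sbr_sr (0 : F) y (0 : L)
  simpa using this

theorem sg_ne (a b : ZMod 2) : sg F a b ≠ 0 := by
  unfold sg; exact pow_ne_zero _ (by simp)

theorem central_right {L : Type v} [AddCommGroup L] [Module F L] [LieSuper F L] {a b : ZMod 2}
    {c w : L} (hc : c ∈ grd F L a) (hw : w ∈ grd F L b) (h : c ∈ centerS F L) :
    sbr F w c = 0 := by
  have h1 := LieSuper.br_skew (F := F) b a w hw c hc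
  have h2 : sbr F c w = 0 := h w
  change sbr F w c = _ • sbr F c w at h1
  rw [h1, h2, smul_zero]

theorem central_right' {L : Type v} [AddCommGroup L] [Module F L] [LieSuper F L] {b : ZMod 2}
    {c w : L} (h : c ∈ centerS F L) (hw : w ∈ grd F L b) :
    sbr F w c = 0 := by
  have hL : IsCompl (grd F L 0) (grd F L 1) := LieSuper.isCompl_gr
  have hl : c ∈ grd F L 0 ⊔ grd F L 1 := by rw [hL.codisjoint.eq_top]; trivial
  obtain ⟨l0, h0, l1, h1, rfl⟩ := Submodule.mem_sup.mp hl
  have hh : sbr F (l0 + l1) w = 0 := h w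
  rw [sbr_al] at hh
  have g0 : sbr F l0 w ∈ grd F L (0 + b) := LieSuper.br_gr (F := F) 0 b l0 h0 w hw
  have g1 : sbr F l1 w ∈ grd F L (1 + b) := LieSuper.br_gr (F := F) 1 b l1 h1 w hw
  have key : ∀ u : L, u ∈ grd F L (0 + b) → u ∈ grd F L (1 + b) → u = 0 := fun u p q => by
    have hb : b = 0 ∨ b = 1 := zm2 b
    rcases hb with rfl | rfl
    · simpa using hL.disjoint.le_bot (Submodule.mem_inf.mpr ⟨p, q⟩)
    · have e : (1 + 1 : ZMod 2) = 0 := by decide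
      rw [e] at q
      simpa using hL.disjoint.le_bot (Submodule.mem_inf.mpr ⟨q, p⟩)
  have z0 : sbr F l0 w = 0 := key _ g0 (by
    rw [eq_neg_of_add_eq_zero_left hh]; exact Submodule.neg_mem _ g1)
  have z1 : sbr F l1 w = 0 := by rwa [z0, zero_add] at hh
  have s0 := LieSuper.br_skew (F := F) b 0 w hw l0 h0
  have s1 := LieSuper.br_skew (F := F) b 1 w hw l1 h1
  change sbr F w l0 = _ • sbr F l0 w at s0
  change sbr F w l1 = _ • sbr F l1 w at s1
  rw [sbr_ar, s0, s1, z0, z1, smul_zero, smul_zero, add_zero]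

theorem jac_central {L : Type v} [AddCommGroup L] [Module F L] [LieSuper F L] {a b c : ZMod 2}
    {x y w : L} (hx : x ∈ grd F L a) (hy : y ∈ grd F L b) (hw : w ∈ grd F L c)
    (h1 : sbr F w x ∈ centerS F L) (h2 : sbr F y w ∈ centerS F L) :
    sbr F (sbr F x y) w = 0 := by
  have hj := LieSuper.br_jacobi (F := F) a b c x hx y hy w hw
  have e1 : LieSuper.br (F := F) x (LieSuper.br (F := F) y w) = 0 :=
    central_right (LieSuper.br_gr (F := F) b c y hy w hw) hx h2
  have e2 : LieSuper.br (F := F) y (LieSuper.br (F := F) w x) = 0 :=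
    central_right (LieSuper.br_gr (F := F) c a w hw x hx) hy h1
  rw [e1, e2, smul_zero, smul_zero, zero_add, zero_add] at hj
  have e3 := (smul_eq_zero.mp hj).resolve_left (sg_ne c b)
  have h4 := LieSuper.br_skew (F := F) (a + b) c _ (LieSuper.br_gr (F := F) a b x hx y hy) w hw
  rw [e3, smul_zero] at h4
  exact h4

theorem hom_lift {L : Type v} {M : Type w} [AddCommGroup L] [Module F L] [LieSuper F L]
    [AddCommGroup M] [Module F M] [LieSuper F M] {f : L →ₗ[F] M} (hf : IsHom F f)
    (hs : Surjective f) {a : ZMod 2} {m : M} (hm : m ∈ grd F M a) :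
    ∃ l ∈ grd F L a, f l = m := by
  obtain ⟨l, rfl⟩ := hs m
  have hL : IsCompl (grd F L 0) (grd F L 1) := LieSuper.isCompl_gr
  have hM : IsCompl (grd F M 0) (grd F M 1) := LieSuper.isCompl_gr
  have hl : l ∈ grd F L 0 ⊔ grd F L 1 := by rw [hL.codisjoint.eq_top]; trivial
  obtain ⟨l0, h0, l1, h1, rfl⟩ := Submodule.mem_sup.mp hl
  have k0 := hf.1 0 l0 h0
  have k1 := hf.1 1 l1 h1
  rw [map_add] at hm ⊢
  have key : ∀ u : M, u ∈ grd F M 0 → u ∈ grd F M 1 → u = 0 := fun u a b => by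
    simpa using hM.disjoint.le_bot (Submodule.mem_inf.mpr ⟨a, b⟩)
  have ha : a = 0 ∨ a = 1 := zm2 a
  rcases ha with rfl | rfl
  · refine ⟨l0, h0, ?_⟩
    have : f l1 = 0 := key _ (by simpa using Submodule.sub_mem _ hm k0) k1
    rw [this, add_zero]
  · refine ⟨l1, h1, ?_⟩
    have : f l0 = 0 := key _ k0 (by simpa using Submodule.sub_mem _ hm k1)
    rw [this, zero_add]

/-- Core of the non-capability argument. -/
theorem not_capable_core {K : Type v} {M : Type w} [AddCommGroup K] [Module F K] [LieSuper F K]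
    [AddCommGroup M] [Module F M] [LieSuper F M] {f : K →ₗ[F] M} (hf : IsHom F f)
    (hs : Surjective f) (hk : LinearMap.ker f = centerS F K)
    {x1 y1 x2 y2 z : M} (hx1 : x1 ∈ grd F M 0) (hy1 : y1 ∈ grd F M 1)
    (hx2 : x2 ∈ grd F M 0) (hy2 : y2 ∈ grd F M 1)
    (hz1 : sbr F x1 y1 = z) (hz2 : sbr F x2 y2 = z)
    (G : Set M) (hG : Submodule.span F G = ⊤)
    (hgr : ∀ g ∈ G, ∃ a, g ∈ grd F M a)
    (hc : ∀ g ∈ G, (sbr F g x1 = 0 ∧ sbr F y1 g = 0) ∨ (sbr F g x2 = 0 ∧ sbr F y2 g = 0)) :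
    z = 0 := by
  obtain ⟨X1, hX1, rfl⟩ := hom_lift hf hs hx1
  obtain ⟨Y1, hY1, rfl⟩ := hom_lift hf hs hy1
  obtain ⟨X2, hX2, rfl⟩ := hom_lift hf hs hx2
  obtain ⟨Y2, hY2, rfl⟩ := hom_lift hf hs hy2
  have cen : ∀ u : K, f u = 0 → u ∈ centerS F K := fun u hu => by
    rw [← hk]; exact hu
  have hd : sbr F X1 Y1 - sbr F X2 Y2 ∈ centerS F K := by
    apply cen
    rw [map_sub, hf.2, hf.2, hz1, hz2, sub_self]
  have hZ : sbr F X1 Y1 ∈ grd F K (0 + 1) := LieSuper.br_gr (F := F) 0 1 X1 hX1 Y1 hY1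
  let S : Submodule F K :=
    { carrier := {w | sbr F (sbr F X1 Y1) w = 0}
      add_mem' := by
        intro g g' h h'
        simp only [Set.mem_setOf_eq] at h h' ⊢
        rw [sbr_ar, h, h', add_zero]
      zero_mem' := sbr_zr _
      smul_mem' := by
        intro c g h
        simp only [Set.mem_setOf_eq] at h ⊢
        rw [sbr_sr, h, smul_zero] }
  have hS : S.map f = ⊤ := by
    rw [eq_top_iff, ← hG, Submodule.span_le]
    intro g hg
    obtain ⟨a, ha⟩ := hgr g hg
    obtain ⟨W, hW, rfl⟩ := hom_lift hf hs ha
    refine ⟨W, ?_, rfl⟩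
    change sbr F (sbr F X1 Y1) W = 0
    rcases hc _ hg with ⟨p, q⟩ | ⟨p, q⟩
    · exact jac_central hX1 hY1 hW (cen _ (by rw [hf.2, p])) (cen _ (by rw [hf.2, q]))
    · have h1 := jac_central hX2 hY2 hW (cen _ (by rw [hf.2, p])) (cen _ (by rw [hf.2, q]))
      have h2 := hd W
      have e : sbr F X1 Y1 = (sbr F X1 Y1 - sbr F X2 Y2) + sbr F X2 Y2 := by abel
      rw [e, sbr_al, h1, h2, add_zero]
  have : sbr F X1 Y1 ∈ centerS F K := fun w => by
    have : f w ∈ S.map f := by rw [hS]; trivial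
    obtain ⟨s, hs1, hs2⟩ := this
    have e : w = s + (w - s) := by abel
    have hs1 : sbr F (sbr F X1 Y1) s = 0 := hs1
    rw [e, sbr_ar, hs1, central_right' (cen (w - s) (by rw [map_sub, hs2, sub_self])) hZ, add_zero]
  rw [← hk] at this
  rw [← hz1, ← hf.2]
  exact this

/-- The central extension `L ⊕ C`, `C ≅ L`, with cocycle `ξ(l) l' - ξ(l') l`. -/
@[reducible] def extLS {L : Type v} {C : Type w} [AddCommGroup L] [Module F L] [LieSuper F L]
    [AddCommGroup C] [Module F C] (e : L ≃ₗ[F] C) (ξ η : L →ₗ[F] F) (z : L)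
    (hξ : ∀ l ∈ grd F L 1, ξ l = 0) (hz : ξ z = 0)
    (hbr : ∀ l l' : L, sbr F l l' = (ξ l * η l' - η l * ξ l') • z) : LieSuper F (L × C) where
  gr a := (grd F L a).prod ((grd F L a).comap e.symm.toLinearMap)
  isCompl_gr := by
    have hA : IsCompl (grd F L 0) (grd F L 1) := LieSuper.isCompl_gr
    constructor
    · rw [disjoint_iff, eq_bot_iff]
      rintro ⟨a, b⟩ h
      rw [Submodule.mem_inf] at h
      obtain ⟨h0, h1⟩ := h
      rw [Submodule.mem_prod] at h0 h1
      have ha : a = 0 := by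
        have := hA.disjoint.le_bot (Submodule.mem_inf.mpr ⟨h0.1, h1.1⟩)
        simpa using this
      have hb : e.symm b = 0 := by
        have := hA.disjoint.le_bot (Submodule.mem_inf.mpr ⟨h0.2, h1.2⟩)
        simpa using this
      have hb : b = 0 := by simpa using hb
      simp [ha, hb, Prod.ext_iff]
    · rw [codisjoint_iff, eq_top_iff]
      rintro ⟨a, b⟩ -
      obtain ⟨b, rfl⟩ := e.surjective b
      have ha' : a ∈ grd F L 0 ⊔ grd F L 1 := by
        rw [hA.codisjoint.eq_top]; trivial
      have hb' : b ∈ grd F L 0 ⊔ grd F L 1 := by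
        rw [hA.codisjoint.eq_top]; trivial
      obtain ⟨a0, ha0, a1, ha1, rfl⟩ := Submodule.mem_sup.mp ha'
      obtain ⟨b0, hb0, b1, hb1, rfl⟩ := Submodule.mem_sup.mp hb'
      refine Submodule.mem_sup.mpr ⟨(a0, e b0), ?_, (a1, e b1), ?_, ?_⟩
      · exact Submodule.mem_prod.mpr ⟨ha0, by simpa using hb0⟩
      · exact Submodule.mem_prod.mpr ⟨ha1, by simpa using hb1⟩
      · simp
  br p q := (sbr F p.1 q.1, e (ξ p.1 • q.1 - ξ q.1 • p.1))
  br_add_left := by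
    intro x y z
    ext
    · simp [sbr_al]
    · simp only [Prod.fst_add, Prod.snd_add, ← map_add]
      congr 1
      simp only [map_add]; module
  br_add_right := by
    intro x y z
    ext
    · simp [sbr_ar]
    · simp only [Prod.fst_add, Prod.snd_add, ← map_add]
      congr 1
      simp only [map_add]; module
  br_smul_left := by
    intro c x y
    ext
    · simp [sbr_sl]
    · simp only [Prod.smul_fst, Prod.smul_snd, ← map_smul]
      congr 1
      simp only [map_smul, smul_eq_mul]; module
  br_smul_right := by
    intro c x y
    ext
    · simp [sbr_sr]
    · simp only [Prod.smul_fst, Prod.smul_snd, ← map_smul]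
      congr 1
      simp only [map_smul, smul_eq_mul]; module
  br_gr := by
    intro a b x hx y hy
    rw [Submodule.mem_prod] at hx hy ⊢
    refine ⟨LieSuper.br_gr a b x.1 hx.1 y.1 hy.1, ?_⟩
    have h1 := hx.1
    have h2 := hy.1
    simp only [Submodule.mem_comap, LinearEquiv.coe_coe, LinearEquiv.symm_apply_apply]
    have ha : a = 0 ∨ a = 1 := zm2 a
    have hb : b = 0 ∨ b = 1 := zm2 b
    rcases ha with rfl | rfl <;> rcases hb with rfl | rfl
    · exact Submodule.sub_mem _ (Submodule.smul_mem _ _ h2) (Submodule.smul_mem _ _ h1)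
    · rw [hξ _ h2, zero_smul, sub_zero]
      exact Submodule.smul_mem _ _ h2
    · rw [hξ _ h1, zero_smul, zero_sub]
      exact Submodule.neg_mem _ (Submodule.smul_mem _ _ h1)
    · rw [hξ _ h1, hξ _ h2]
      simp
  br_skew := by
    intro a b x hx y hy
    rw [Submodule.mem_prod] at hx hy
    rw [Prod.ext_iff]
    refine ⟨LieSuper.br_skew (F := F) a b x.1 hx.1 y.1 hy.1, ?_⟩
    have h1 := hx.1
    have h2 := hy.1
    simp only [Prod.smul_snd, ← map_smul]
    congr 1
    have ha : a = 0 ∨ a = 1 := zm2 a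
    have hb : b = 0 ∨ b = 1 := zm2 b
    rcases ha with rfl | rfl <;> rcases hb with rfl | rfl
    · simp [sg]
    · simp [sg]
    · simp [sg]
    · rw [hξ _ h1, hξ _ h2]
      simp
  br_jacobi := by
    intro a b c x hx y hy w hw
    rw [Submodule.mem_prod] at hx hy hw
    rw [Prod.ext_iff]
    refine ⟨LieSuper.br_jacobi (F := F) a b c x.1 hx.1 y.1 hy.1 w.1 hw.1, ?_⟩
    have h1 : a = 1 → ξ x.1 = 0 := fun h => hξ _ (h ▸ hx.1)
    have h2 : b = 1 → ξ y.1 = 0 := fun h => hξ _ (h ▸ hy.1)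
    have h3 : c = 1 → ξ w.1 = 0 := fun h => hξ _ (h ▸ hw.1)
    clear hx hy hw
    simp only [Prod.smul_snd, Prod.snd_add, ← map_smul, ← map_add, hbr]
    simp only [map_smul, hz, smul_zero, zero_smul, sub_zero]
    rw [Prod.snd_zero, ← map_zero e]
    congr 1
    have ha : a = 0 ∨ a = 1 := zm2 a
    have hb : b = 0 ∨ b = 1 := zm2 b
    have hc : c = 0 ∨ c = 1 := zm2 c
    rcases ha with rfl | rfl <;> rcases hb with rfl | rfl <;> rcases hc with rfl | rfl <;>
      (try simp only [forall_const] at h1 h2 h3) <;> simp only [h1, h2, h3, sg, ZMod.val_zero, ZMod.val_one,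
        mul_zero, zero_mul, pow_zero, one_smul, zero_smul, smul_zero, add_zero, sub_zero,
        zero_sub, mul_one, sub_self] <;> module

theorem capable_core {L : Type v} [AddCommGroup L] [Module F L] [LieSuper F L]
    (ξ η : L →ₗ[F] F) (x y z : L)
    (hξ : ∀ l ∈ grd F L 1, ξ l = 0) (hz : ξ z = 0) (hx : ξ x = 1) (hxy : sbr F x y ≠ 0)
    (hbr : ∀ l l' : L, sbr F l l' = (ξ l * η l' - η l * ξ l') • z) : Capable F L := by
  let e : L ≃ₗ[F] ULift.{u} L := ULift.moduleEquiv.symm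
  letI : LieSuper F (L × ULift.{u} L) := extLS e ξ η z hξ hz hbr
  refine ⟨⟨L × ULift.{u} L⟩, LinearMap.fst F L (ULift.{u} L), ⟨?_, ?_⟩, ?_, ?_⟩
  · intro a p hp
    exact hp.1
  · intro p q
    rfl
  · exact LinearMap.fst_surjective
  · ext ⟨l, c⟩
    constructor
    · intro h
      have h : l = 0 := h
      subst h
      intro q
      change (sbr F 0 q.1, e (ξ 0 • q.1 - ξ q.1 • (0 : L))) = 0
      simp [sbr_zl]
    · intro h
      change l = 0
      have h1 : (sbr F l x, e (ξ l • x - ξ x • l)) = 0 := h (x, 0)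
      have h2 : (sbr F l y, e (ξ l • y - ξ y • l)) = 0 := h (y, 0)
      have h1 := (Prod.ext_iff.mp h1).2
      have h2 : sbr F l y = 0 := (Prod.ext_iff.mp h2).1
      have h1 : ξ l • x - ξ x • l = 0 := e.map_eq_zero_iff.mp h1
      rw [hx, one_smul, sub_eq_zero] at h1
      rw [← h1, sbr_sl] at h2
      rw [← h1, (smul_eq_zero.mp h2).resolve_right hxy, zero_smul]

end aux

/-- for any `m ≥ 1` and any `r + s ≥ 1`, the nilpotent Lie
superalgebra `H_m ⊕ A(r | s)` is capable if and only if `m = 1`. -/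
theorem heisenberg_odd_sum_abelian_capable_iff (F : Type u) [Field F]
    (hchar2 : (2 : F) ≠ 0) (hchar3 : (3 : F) ≠ 0)
    (m r s : ℕ) (hm : 1 ≤ m) (hrs : 1 ≤ r + s)
    (H : Type v) [AddCommGroup H] [Module F H] [LieSuper F H]
    (hH : IsHeisO F m H)
    (A : Type v) [AddCommGroup A] [Module F A] [LieSuper F A]
    (hA : IsAbelSuper F r s A) :
    Capable F (H × A) ↔ m = 1 := by
  obtain ⟨x, y, z, hx, hy, hz, hli, hsp, hxx, hxy, hyx, hyy, hz1, hz2⟩ := hH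
  have hz0 : z ≠ 0 := by simpa using hli.ne_zero (Sum.inr (Sum.inr ()))
  have hab := hA.1
  have hgA : ∀ a : ZMod 2, (0 : A) ∈ grd F A a := fun a => Submodule.zero_mem _
  have hgH : ∀ a : ZMod 2, (0 : H) ∈ grd F H a := fun a => Submodule.zero_mem _
  constructor
  · rintro ⟨K, f, hf, hs, hk⟩
    by_contra hm1
    have h2 : 2 ≤ m := by omega
    let i1 : Fin m := ⟨0, by omega⟩
    let i2 : Fin m := ⟨1, by omega⟩
    have hne : i1 ≠ i2 := by simp [i1, i2]
    have hAc : IsCompl (grd F A 0) (grd F A 1) := LieSuper.isCompl_gr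
    let G : Set (H × A) :=
      (LinearMap.inl F H A '' Set.range (Sum.elim x (Sum.elim y (fun _ : Unit => z)))) ∪
      (LinearMap.inr F H A '' ((grd F A 0 : Set A) ∪ (grd F A 1 : Set A)))
    have hG : Submodule.span F G = ⊤ := by
      rw [Submodule.span_union, Submodule.span_image, Submodule.span_image, hsp,
        Submodule.span_union, Submodule.span_eq, Submodule.span_eq, hAc.codisjoint.eq_top,
        Submodule.map_top, Submodule.map_top, LinearMap.sup_range_inl_inr]
    have hbr : ∀ p q : H × A, sbr F p q = (sbr F p.1 q.1, 0) := by
      intro p q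
      rw [← hab p.2 q.2]; rfl
    have key := not_capable_core hf hs hk (x1 := (x i1, 0)) (y1 := (y i1, 0))
      (x2 := (x i2, 0)) (y2 := (y i2, 0)) (z := (z, 0))
      ⟨hx _, hgA _⟩ ⟨hy _, hgA _⟩ ⟨hx _, hgA _⟩ ⟨hy _, hgA _⟩
      (by simp [hbr, hxy]) (by simp [hbr, hxy]) G hG
      (by
        rintro g (⟨-, ⟨i | j | k, rfl⟩, rfl⟩ | ⟨a, h | h, rfl⟩)
        · exact ⟨0, hx _, hgA _⟩
        · exact ⟨1, hy _, hgA _⟩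
        · exact ⟨1, hz, hgA _⟩
        · exact ⟨0, hgH _, h⟩
        · exact ⟨1, hgH _, h⟩)
      (by
        rintro g (⟨-, ⟨i | j | k, rfl⟩, rfl⟩ | ⟨a, h, rfl⟩)
        · by_cases hi : i = i1
          · right; subst hi; simp [hbr, hxx, hyx, hne]
          · left; simp [hbr, hxx, hyx, hi]
        · by_cases hi : j = i1
          · right; subst hi; simp [hbr, hyy, hyx, hne.symm]
          · left; simp [hbr, hyy, hyx, Ne.symm hi]
        · left; simp [hbr, hz1, hz2]
        · left; simp [hbr, sbr_zl, sbr_zr])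
    exact hz0 (Prod.ext_iff.mp key).1
  · rintro rfl
    let b := Basis.mk hli hsp.ge
    let ξ : H →ₗ[F] F := b.coord (Sum.inl 0)
    let η : H →ₗ[F] F := b.coord (Sum.inr (Sum.inl 0))
    let ζ : H →ₗ[F] F := b.coord (Sum.inr (Sum.inr ()))
    have hdec : ∀ h : H, h = ξ h • x 0 + (η h • y 0 + ζ h • z) := by
      intro h
      have := b.sum_repr h
      simpa [b, ξ, η, ζ] using this.symm
    have hξx : ξ (x 0) = 1 := by
      have := b.repr_self (Sum.inl 0)
      simp only [b, Basis.mk_apply, Sum.elim_inl] at this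
      simp [ξ, b, this]
    have hξz : ξ z = 0 := by
      have := b.repr_self (Sum.inr (Sum.inr ()))
      simp only [b, Basis.mk_apply, Sum.elim_inr] at this
      simp [ξ, b, this]
    have hHc : IsCompl (grd F H 0) (grd F H 1) := LieSuper.isCompl_gr
    have hx0 : x 0 ≠ 0 := by simpa using hli.ne_zero (Sum.inl 0)
    have hξ1 : ∀ l ∈ grd F H 1, ξ l = 0 := by
      intro l hl
      have h1 : ξ l • x 0 ∈ grd F H 1 := by
        have e : ξ l • x 0 = l - (η l • y 0 + ζ l • z) := eq_sub_of_add_eq (hdec l).symm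
        rw [e]
        exact Submodule.sub_mem _ hl (Submodule.add_mem _ (Submodule.smul_mem _ _ (hy 0))
          (Submodule.smul_mem _ _ hz))
      have h2 : ξ l • x 0 = 0 := by
        simpa only [Submodule.mem_bot] using
          hHc.disjoint.le_bot (Submodule.mem_inf.mpr ⟨Submodule.smul_mem _ _ (hx 0), h1⟩)
      exact (smul_eq_zero.mp h2).resolve_right hx0
    have hbrH : ∀ l l' : H, sbr F l l' = (ξ l * η l' - η l * ξ l') • z := by
      intro l l'
      conv_lhs => rw [hdec l, hdec l']
      simp only [sbr_al, sbr_ar, sbr_sl, sbr_sr, hxx, hxy, hyx, hyy, hz1, hz2, if_true]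
      module
    refine capable_core (ξ ∘ₗ LinearMap.fst F H A) (η ∘ₗ LinearMap.fst F H A)
      (x 0, 0) (y 0, 0) (z, 0) ?_ hξz hξx ?_ ?_
    · intro l hl
      exact hξ1 _ hl.1
    · intro h
      have h : sbr F (x 0) (y 0) = 0 := (Prod.ext_iff.mp h).1
      rw [hxy, if_pos rfl] at h
      exact hz0 h
    · intro p q
      change (sbr F p.1 q.1, sbr F p.2 q.2) = _
      rw [hab, hbrH]
      simp

end SuperLie
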